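/- Let φ¹, φ², φ³ : ℝ² → ℝ be infinitely differentiable and define σ^{1,1} = ∂₂φ¹, σ^{1,2} = −∂₁φ¹, σ^{2,1} = −∂₂φ², σ^{2,2} = ∂₁φ², μ¹ = ∂₂φ³ + φ¹, μ² = −∂₁φ³ − φ². Then the Cosserat equations hold identically on ℝ²: ∂₁σ^{1,1} + ∂₂σ^{1,2} = 0, ∂₁σ^{2,1} + ∂₂σ^{2,2} = 0, and ∂₁μ¹ + ∂₂μ² + σ^{1,2} − σ^{2,1} = 0. -/

import Mathlib

/-- Partial derivative of a scalar function on ℝⁿ in the i-th coordinate direction. -/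
noncomputable def pd {n : ℕ} (i : Fin n) (f : (Fin n → ℝ) → ℝ) (x : Fin n → ℝ) : ℝ :=
  fderiv ℝ f x (Pi.single i 1)

theorem two_le_smooth : (2 : WithTop ℕ∞) ≤ ((⊤ : ℕ∞) : WithTop ℕ∞) :=
  WithTop.coe_le_coe.2 (le_top : (2 : ℕ∞) ≤ ⊤)

theorem pd_differentiable {f : (Fin 2 → ℝ) → ℝ} (h : ContDiff ℝ (⊤ : ℕ∞) f) (i : Fin 2) :
    Differentiable ℝ (pd i f) := by
  have h' : Differentiable ℝ (fderiv ℝ f) :=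
    (h.fderiv_right (m := 1) (by rw [one_add_one_eq_two]; exact two_le_smooth)).differentiable (by simp)
  exact fun x => (h' x).clm_apply (differentiableAt_const _)

theorem pd_pd_eq {f : (Fin 2 → ℝ) → ℝ} (h : ContDiff ℝ (⊤ : ℕ∞) f) (i j : Fin 2)
    (x : Fin 2 → ℝ) : pd i (pd j f) x = fderiv ℝ (fderiv ℝ f) x (Pi.single i 1) (Pi.single j 1) := by
  have h' : Differentiable ℝ (fderiv ℝ f) :=
    (h.fderiv_right (m := 1) (by rw [one_add_one_eq_two]; exact two_le_smooth)).differentiable (by simp)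
  have := ((h' x).hasFDerivAt.clm_apply (hasFDerivAt_const (Pi.single j (1:ℝ)) x)).fderiv
  change fderiv ℝ (fun y => fderiv ℝ f y (Pi.single j 1)) x (Pi.single i 1) = _
  rw [this]
  simp

theorem pd_comm {f : (Fin 2 → ℝ) → ℝ} (h : ContDiff ℝ (⊤ : ℕ∞) f) (i j : Fin 2)
    (x : Fin 2 → ℝ) : pd i (pd j f) x = pd j (pd i f) x := by
  rw [pd_pd_eq h, pd_pd_eq h]
  exact (h.contDiffAt.isSymmSndFDerivAt (by simpa using two_le_smooth)) _ _

theorem pd_neg (i : Fin 2) (f : (Fin 2 → ℝ) → ℝ) (x : Fin 2 → ℝ) :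
    pd i (fun y => - f y) x = - pd i f x := by
  simp [pd, fderiv_fun_neg]

theorem pd_add (i : Fin 2) {f g : (Fin 2 → ℝ) → ℝ} (hf : Differentiable ℝ f)
    (hg : Differentiable ℝ g) (x : Fin 2 → ℝ) :
    pd i (fun y => f y + g y) x = pd i f x + pd i g x := by
  simp [pd, fderiv_fun_add (hf x) (hg x)]

theorem pd_sub (i : Fin 2) {f g : (Fin 2 → ℝ) → ℝ} (hf : Differentiable ℝ f)
    (hg : Differentiable ℝ g) (x : Fin 2 → ℝ) :
    pd i (fun y => f y - g y) x = pd i f x - pd i g x := by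
  simp [pd, fderiv_fun_sub (hf x) (hg x)]

/-- The parametrization σ^{1,1} = ∂₂φ¹, σ^{1,2} = −∂₁φ¹, σ^{2,1} = −∂₂φ², σ^{2,2} = ∂₁φ²,
μ¹ = ∂₂φ³ + φ¹, μ² = −∂₁φ³ − φ² by three smooth potentials satisfies the source-free
Cosserat equations on ℝ². -/
theorem stmt_3 (φ1 φ2 φ3 : (Fin 2 → ℝ) → ℝ)
    (h1 : ContDiff ℝ (⊤ : ℕ∞) φ1) (h2 : ContDiff ℝ (⊤ : ℕ∞) φ2) (h3 : ContDiff ℝ (⊤ : ℕ∞) φ3)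
    (σ : Fin 2 → Fin 2 → (Fin 2 → ℝ) → ℝ) (μ : Fin 2 → (Fin 2 → ℝ) → ℝ)
    (hσ11 : ∀ x, σ 0 0 x = pd 1 φ1 x)
    (hσ12 : ∀ x, σ 0 1 x = - pd 0 φ1 x)
    (hσ21 : ∀ x, σ 1 0 x = - pd 1 φ2 x)
    (hσ22 : ∀ x, σ 1 1 x = pd 0 φ2 x)
    (hμ1 : ∀ x, μ 0 x = pd 1 φ3 x + φ1 x)
    (hμ2 : ∀ x, μ 1 x = - pd 0 φ3 x - φ2 x) :
    (∀ x, pd 0 (σ 0 0) x + pd 1 (σ 0 1) x = 0) ∧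
    (∀ x, pd 0 (σ 1 0) x + pd 1 (σ 1 1) x = 0) ∧
    (∀ x, pd 0 (μ 0) x + pd 1 (μ 1) x + σ 0 1 x - σ 1 0 x = 0) := by
  have d1 : Differentiable ℝ φ1 := h1.differentiable (by simp)
  have d2 : Differentiable ℝ φ2 := h2.differentiable (by simp)
  have e11 : σ 0 0 = pd 1 φ1 := funext hσ11
  have e12 : σ 0 1 = fun x => - pd 0 φ1 x := funext hσ12
  have e21 : σ 1 0 = fun x => - pd 1 φ2 x := funext hσ21
  have e22 : σ 1 1 = pd 0 φ2 := funext hσ22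
  have m1 : μ 0 = fun x => pd 1 φ3 x + φ1 x := funext hμ1
  have m2 : μ 1 = fun x => - pd 0 φ3 x - φ2 x := funext hμ2
  refine ⟨fun x => ?_, fun x => ?_, fun x => ?_⟩
  · rw [e11, e12, pd_neg, pd_comm h1]; ring
  · rw [e21, e22, pd_neg, pd_comm h2]; ring
  · rw [hσ12, hσ21, m1, m2, pd_add _ (pd_differentiable h3 1) d1,
      pd_sub _ (pd_differentiable h3 0).fun_neg d2, pd_neg, pd_comm h3]
    ring
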